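/- Let g : ℝ≥0 → ℝ≥0 satisfy g(t) ~ t^(-β) L(t) as t → ∞ for some β > 1 and L slowly varying at infinity. Then ∫ₜ^∞ g(s) ds ~ t^(-β+1) L(t)/(β-1) as t → ∞. -/

import Mathlib

open Filter MeasureTheory

/-- `g` is regularly varying at infinity with index `ρ`. -/
def RegularlyVarying (g : ℝ → ℝ) (ρ : ℝ) : Prop :=
  ∀ x : ℝ, 0 < x → Tendsto (fun t : ℝ => g (x * t) / g t) atTop (nhds (x ^ ρ))

namespace RegularlyVarying

variable {g : ℝ → ℝ} {ρ : ℝ}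

theorem eventually_pos (h : RegularlyVarying g ρ) (hg0 : ∀ t, 0 ≤ g t) :
    ∀ᶠ t in atTop, 0 < g t := by
  have h1 := h 1 one_pos
  rw [Real.one_rpow] at h1
  filter_upwards [h1.eventually_ne one_ne_zero] with t ht
  refine (hg0 t).lt_of_ne fun h0 => ht ?_
  simp [← h0]

theorem congr {f : ℝ → ℝ} (h : RegularlyVarying g ρ) (hfg : f =ᶠ[atTop] g) :
    RegularlyVarying f ρ := by
  intro x hx
  refine (h x hx).congr' ?_
  filter_upwards [hfg, (tendsto_id.const_mul_atTop hx).eventually hfg] with t h1 h2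
  simp only [id] at h2
  rw [h1, h2]

/-- A function asymptotic to a power times a slowly varying function is regularly varying. -/
theorem of_slowlyVarying {L : ℝ → ℝ}
    (hslow : ∀ x : ℝ, 0 < x → Tendsto (fun t : ℝ => L (x * t) / L t) atTop (nhds 1))
    (hasymp : Tendsto (fun t : ℝ => g t / (t ^ ρ * L t)) atTop (nhds 1)) :
    RegularlyVarying g ρ := by
  intro x hx
  have hxt : Tendsto (fun t : ℝ => x * t) atTop atTop := tendsto_id.const_mul_atTop hx
  have hL : ∀ᶠ t in atTop, L t ≠ 0 := by
    filter_upwards [(hslow 1 one_pos).eventually_ne one_ne_zero] with t ht h0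
    simp [h0] at ht
  have hlim := (((hasymp.comp hxt).mul (hslow x hx)).mul_const (x ^ ρ)).div hasymp one_ne_zero
  simp only [one_mul, div_one] at hlim
  refine hlim.congr' ?_
  filter_upwards [hL, hxt.eventually hL, eventually_gt_atTop 0] with t h1 h2 ht
  have h3 := (Real.rpow_pos_of_pos ht ρ).ne'
  have h4 := (Real.rpow_pos_of_pos hx ρ).ne'
  simp only [Pi.div_apply, Function.comp_apply, Real.mul_rpow hx.le ht.le]
  field_simp

theorem tendstoInMeasure (h : RegularlyVarying g ρ) (hg : Integrable g) :
    TendstoInMeasure (volume.restrict (Set.Icc (1 : ℝ) 4)) (fun t y => g (y * t) / g t) atTop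
      (fun y => y ^ ρ) := by
  intro ε hε
  refine tendsto_of_seq_tendsto fun u hu => ?_
  refine tendstoInMeasure_of_tendsto_ae (f := fun n y => g (y * u n) / g (u n)) (fun n => ?_) ?_
    ε hε
  · rcases eq_or_ne (u n) 0 with h0 | h0
    · simpa [h0] using aestronglyMeasurable_const
    · exact ((hg.comp_mul_right' h0).div_const _).aestronglyMeasurable.restrict
  · filter_upwards [ae_restrict_mem measurableSet_Icc] with y hy
    exact (h y (one_pos.trans_le hy.1)).comp hu

theorem eventually_le_on_Icc (h : RegularlyVarying g ρ) (hρ : ρ ≤ 0) (hg0 : ∀ t, 0 ≤ g t)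
    (hg : Integrable g) :
    ∃ C : ℝ, 0 < C ∧ ∀ᶠ t in atTop, ∀ x ∈ Set.Icc (1 : ℝ) 2, g (x * t) ≤ C * g t := by
  set δ : ℝ := 2 ^ ρ / 2 with hδ
  have h2 : (0 : ℝ) < 2 ^ ρ := by positivity
  have h21 : (2 : ℝ) ^ ρ ≤ 1 := Real.rpow_le_one_of_one_le_of_nonpos one_le_two hρ
  have hδ0 : 0 < δ := by positivity
  have hmeas := (tendstoInMeasure_iff_dist.1 (h.tendstoInMeasure hg) δ hδ0).eventually_lt_const
    (show (0 : ENNReal) < ENNReal.ofReal (1 / 4) by simp)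
  obtain ⟨T, hT⟩ := eventually_atTop.1
    (hmeas.and ((h.eventually_pos hg0).and (eventually_gt_atTop 0)))
  refine ⟨2 / δ, by positivity, ?_⟩
  filter_upwards [eventually_ge_atTop T] with t ht x hx
  have hx0 : 0 < x := one_pos.trans_le hx.1
  obtain ⟨hEt, hgt, ht0⟩ := hT t ht
  obtain ⟨hExt, hgxt, -⟩ := hT (x * t) (ht.trans (le_mul_of_one_le_left ht0.le hx.1))
  rw [Measure.restrict_apply' measurableSet_Icc] at hEt hExt
  set E : ℝ → Set ℝ := fun t => {y | δ ≤ dist (g (y * t) / g t) (y ^ ρ)} ∩ Set.Icc 1 4 with hE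
  have hpre : volume ((x * ·) ⁻¹' E t) ≤ ENNReal.ofReal (1 / 4) := by
    rw [Real.volume_preimage_mul_left hx0.ne']
    refine (mul_le_of_le_one_left (zero_le) ?_).trans hEt.le
    rw [abs_of_pos (inv_pos.2 hx0), ENNReal.ofReal_le_one]
    exact inv_le_one_of_one_le₀ hx.1
  obtain ⟨z, hz, hzE⟩ : ∃ z ∈ Set.Icc (1 : ℝ) 2, z ∉ E (x * t) ∪ (x * ·) ⁻¹' E t := by
    by_contra! hsub
    have h1 := (measure_mono (μ := volume) hsub).trans
      ((measure_union_le _ _).trans (add_le_add hExt.le hpre))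
    rw [Real.volume_Icc, ← ENNReal.ofReal_add (by norm_num) (by norm_num),
      ENNReal.ofReal_le_ofReal_iff (by norm_num)] at h1
    norm_num at h1
  rw [Set.mem_union, not_or] at hzE
  have hz0 : 0 < z := one_pos.trans_le hz.1
  have hz1 : dist (g (z * (x * t)) / g (x * t)) (z ^ ρ) < δ := by
    by_contra! hc
    exact hzE.1 ⟨hc, hz.1, by linarith [hz.2]⟩
  have hz2 : dist (g (x * z * t) / g t) ((x * z) ^ ρ) < δ := by
    by_contra! hc
    exact hzE.2 ⟨hc, by nlinarith [hx.1, hz.1], by nlinarith [hx.1, hz.1, hx.2, hz.2]⟩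
  have hz3 : (2 : ℝ) ^ ρ ≤ z ^ ρ := Real.rpow_le_rpow_of_nonpos hz0 hz.2 hρ
  have hz4 : (x * z) ^ ρ ≤ 1 :=
    Real.rpow_le_one_of_one_le_of_nonpos (by nlinarith [hx.1, hz.1]) hρ
  rw [Real.dist_eq, abs_lt] at hz1 hz2
  have hlow : δ * g (x * t) ≤ g (z * (x * t)) := by
    rw [← le_div_iff₀ hgxt]; linarith
  have hup : g (x * z * t) ≤ 2 * g t := by
    rw [← div_le_iff₀ hgt]; linarith
  rw [show z * (x * t) = x * z * t by ring] at hlow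
  rw [div_mul_eq_mul_div, le_div_iff₀ hδ0]
  linarith

/-- A bound of Potter type: the ratios `g (x * t) / g t` are dominated by a power of `x`. -/
theorem eventually_le_rpow (h : RegularlyVarying g ρ) (hρ : ρ ≤ 0) (hg0 : ∀ t, 0 ≤ g t)
    (hg : Integrable g) {σ : ℝ} (hρσ : ρ < σ) (hσ : σ ≤ 0) :
    ∃ C : ℝ, ∀ᶠ t in atTop, ∀ x : ℝ, 1 ≤ x → g (x * t) ≤ C * x ^ σ * g t := by
  obtain ⟨C, hC, hloc⟩ := h.eventually_le_on_Icc hρ hg0 hg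
  have htwo := (h 2 two_pos).eventually_le_const (Real.rpow_lt_rpow_of_exponent_lt one_lt_two hρσ)
  obtain ⟨T, hT⟩ := eventually_atTop.1
    (hloc.and (htwo.and ((h.eventually_pos hg0).and (eventually_gt_atTop 0))))
  set D := C / 2 ^ σ with hD
  have hD0 : 0 < D := by positivity
  have key : ∀ n : ℕ, ∀ t, T ≤ t → ∀ x : ℝ, 1 ≤ x → x ≤ 2 ^ (n + 1) →
      g (x * t) ≤ D * x ^ σ * g t := by
    intro n
    induction n with
    | zero =>
      intro t ht x hx hx2
      obtain ⟨h1, -, hgt, -⟩ := hT t ht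
      rw [zero_add, pow_one] at hx2
      refine (h1 x ⟨hx, hx2⟩).trans (mul_le_mul_of_nonneg_right ?_ hgt.le)
      rw [hD, div_mul_eq_mul_div, le_div_iff₀ (by positivity)]
      exact mul_le_mul_of_nonneg_left
        (Real.rpow_le_rpow_of_nonpos (one_pos.trans_le hx) hx2 hσ) hC.le
    | succ n ih =>
      intro t ht x hx hx2
      rcases le_total x 2 with hx' | hx'
      · exact ih t ht x hx (hx'.trans (le_self_pow₀ one_le_two n.succ_ne_zero))
      obtain ⟨-, h2, hgt, ht0⟩ := hT t ht
      rw [div_le_iff₀ hgt] at h2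
      have hx2' : x / 2 ≤ 2 ^ (n + 1) := by
        rw [div_le_iff₀ two_pos, ← pow_succ]; exact hx2
      have h3 := ih (2 * t) (by linarith) (x / 2) (by linarith) hx2'
      rw [show x / 2 * (2 * t) = x * t by ring] at h3
      have hx0 : 0 ≤ x / 2 := by linarith
      calc g (x * t) ≤ D * (x / 2) ^ σ * g (2 * t) := h3
        _ ≤ D * (x / 2) ^ σ * (2 ^ σ * g t) := by gcongr
        _ = D * ((x / 2) ^ σ * 2 ^ σ) * g t := by ring
        _ = D * x ^ σ * g t := by
          rw [← Real.mul_rpow hx0 zero_le_two, div_mul_cancel₀ x two_ne_zero]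
  refine ⟨D, ?_⟩
  filter_upwards [eventually_ge_atTop T] with t ht x hx
  obtain ⟨n, hn⟩ := pow_unbounded_of_one_lt x (one_lt_two (α := ℝ))
  exact key n t ht x hx (hn.le.trans (pow_le_pow_right₀ one_le_two n.le_succ))

/-- Karamata's theorem for the tail integral of an integrable regularly varying function. -/
theorem tendsto_integral_Ioi_div (h : RegularlyVarying g ρ) (hρ : ρ < -1) (hg0 : ∀ t, 0 ≤ g t)
    (hg : Integrable g) :
    Tendsto (fun t : ℝ => (∫ s in Set.Ioi t, g s) / (t * g t)) atTop (nhds (-1 / (ρ + 1))) := by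
  obtain ⟨σ, hρσ, hσ⟩ := exists_between hρ
  obtain ⟨C, hC⟩ := h.eventually_le_rpow (by linarith) hg0 hg hρσ (by linarith)
  have hlim : Tendsto (fun t : ℝ => ∫ x in Set.Ioi (1 : ℝ), g (x * t) / g t) atTop
      (nhds (∫ x in Set.Ioi (1 : ℝ), x ^ ρ)) := by
    refine tendsto_integral_filter_of_dominated_convergence (fun x => C * x ^ σ) ?_ ?_
      ((integrableOn_Ioi_rpow_of_lt hσ one_pos).const_mul C) ?_
    · filter_upwards [eventually_ne_atTop 0] with t ht
      exact ((hg.comp_mul_right' ht).div_const _).aestronglyMeasurable.restrict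
    · filter_upwards [hC, h.eventually_pos hg0] with t ht hgt
      filter_upwards [ae_restrict_mem measurableSet_Ioi] with x hx
      rw [Real.norm_of_nonneg (div_nonneg (hg0 _) hgt.le), div_le_iff₀ hgt]
      exact ht x (le_of_lt hx)
    · filter_upwards [ae_restrict_mem measurableSet_Ioi] with x hx
      exact h x (one_pos.trans hx)
  rw [integral_Ioi_rpow_of_lt hρ one_pos, Real.one_rpow] at hlim
  refine hlim.congr' ?_
  filter_upwards [eventually_gt_atTop 0] with t ht
  rw [integral_div, integral_comp_mul_right_Ioi g 1 ht, one_mul, smul_eq_mul, inv_mul_eq_div,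
    div_div]

end RegularlyVarying

/-- If `g(t) ~ t^(-β) L(t)` as `t → ∞` with `β > 1` and `L` slowly varying, and `g` is
integrable on `[t,∞)` for large `t`, then `∫ₜ^∞ g(s) ds ~ t^(-β+1) L(t)/(β-1)`. -/
theorem stmt2 (g : ℝ → ℝ) (hg0 : ∀ t, 0 ≤ g t)
    (L : ℝ → ℝ) (hL0 : ∀ t, 0 ≤ L t)
    (hslow : ∀ x : ℝ, 0 < x →
      Tendsto (fun t : ℝ => L (x * t) / L t) atTop (nhds 1))
    (β : ℝ) (hβ : 1 < β)
    (hasymp : Tendsto (fun t : ℝ => g t / (t ^ (-β) * L t)) atTop (nhds 1))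
    (hint : ∀ᶠ t : ℝ in atTop, IntegrableOn g (Set.Ici t)) :
    Tendsto (fun t : ℝ =>
        (∫ s in Set.Ici t, g s) / (t ^ (-β + 1) * L t / (β - 1)))
      atTop (nhds 1) := by
  have hreg : RegularlyVarying g (-β) := .of_slowlyVarying hslow hasymp
  obtain ⟨t₀, ht₀⟩ := hint.exists
  set f : ℝ → ℝ := (Set.Ici t₀).indicator g with hf
  have hfg : ∀ t, t₀ ≤ t → f t = g t := fun t ht => Set.indicator_of_mem (Set.mem_Ici.2 ht) g
  have hfreg : RegularlyVarying f (-β) :=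
    hreg.congr (by filter_upwards [eventually_ge_atTop t₀] with t ht using hfg t ht)
  have hlim := hfreg.tendsto_integral_Ioi_div (by linarith)
    (Set.indicator_nonneg fun t _ => hg0 t) (ht₀.integrable_indicator measurableSet_Ici)
  have hβ0 : β - 1 ≠ 0 := by linarith
  have hmul := (hlim.mul hasymp).mul_const (β - 1)
  rw [show -1 / (-β + 1) * 1 * (β - 1) = 1 by
    rw [show -β + 1 = -(β - 1) by ring, neg_div_neg_eq, mul_one, one_div_mul_cancel hβ0]] at hmul
  refine hmul.congr' ?_
  filter_upwards [eventually_ge_atTop t₀, eventually_gt_atTop 0, hreg.eventually_pos hg0]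
    with t ht ht0 hgt
  rw [integral_Ici_eq_integral_Ioi, hfg t ht,
    setIntegral_congr_fun measurableSet_Ioi fun s hs => hfg s (ht.trans (le_of_lt hs)),
    Real.rpow_add ht0, Real.rpow_one]
  have hpow := (Real.rpow_pos_of_pos ht0 (-β)).ne'
  field_simp
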